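/- The expressivity of UA ranking functions strictly increases in the number of labels: for n ≥ L, the image of the UA ranking function on n×L prediction matrices strictly contains the image of the UA ranking function on n×(L-1) prediction matrices. -/

import Mathlib

open Finset

/-- An `n × L` matrix is row-stochastic (a prediction matrix) if every row is a
probability distribution over the `L` labels. Labels are ordered: a higher
index in `Fin L` is a better label. -/
def rowStochastic {n L : ℕ} (P : Fin n → Fin L → ℝ) : Prop :=
  (∀ i ℓ, 0 ≤ P i ℓ) ∧ ∀ i, ∑ ℓ, P i ℓ = 1

/-- `N^{>ℓ}`: the number of individuals whose label is strictly better than `ℓ`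
under the label assignment `lam`. -/
def nGT {n L : ℕ} (lam : Fin n → Fin L) (ℓ : Fin L) : ℕ :=
  (Finset.univ.filter fun j => ℓ < lam j).card

/-- `N^{=ℓ}`: the number of individuals whose label equals `ℓ`. -/
def nEQ {n L : ℕ} (lam : Fin n → Fin L) (ℓ : Fin L) : ℕ :=
  (Finset.univ.filter fun j => lam j = ℓ).card

/-- `N^{>ℓ}_{−i}`: the number of individuals other than `i` whose label is
strictly better than `ℓ`. -/
def nGTm {n L : ℕ} (lam : Fin n → Fin L) (i : Fin n) (ℓ : Fin L) : ℕ :=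
  ((Finset.univ.erase i).filter fun j => ℓ < lam j).card

/-- `N^{=ℓ}_{−i}`: the number of individuals other than `i` whose label equals
`ℓ`. -/
def nEQm {n L : ℕ} (lam : Fin n → Fin L) (i : Fin n) (ℓ : Fin L) : ℕ :=
  ((Finset.univ.erase i).filter fun j => lam j = ℓ).card

/-- Conditioned on the full label assignment `lam`, the probability that
individual `i` receives (0-indexed) rank `k` when individuals are sorted by
decreasing label with uniform tie-breaking: it is `1 / N^{=λᵢ}` if
`N^{>λᵢ} ≤ k < N^{>λᵢ} + N^{=λᵢ}` and `0` otherwise. -/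
noncomputable def condRank {n L : ℕ} (lam : Fin n → Fin L) (i k : Fin n) : ℝ :=
  if nGT lam (lam i) ≤ k.val ∧ k.val < nGT lam (lam i) + nEQ lam (lam i)
  then ((nEQ lam (lam i) : ℝ))⁻¹ else 0

/-- The uncertainty aware (UA) ranking function: `rUA P i k` is the probability
that individual `i` receives rank `k` when labels `λ_j ∼ P j` are drawn
independently and individuals are ranked by decreasing label with uniform
tie-breaking. -/
noncomputable def rUA {n L : ℕ} (P : Fin n → Fin L → ℝ) : Fin n → Fin n → ℝ :=
  fun i k => ∑ lam : Fin n → Fin L, (∏ j, P j (lam j)) * condRank lam i k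

/-- The probability, under the UA ranking for prediction matrix `P`, that
individual `i` receives rank `k`, conditioned on `λ_i = ℓ` (the labels of the
other individuals being drawn independently from the rows of `P`). -/
noncomputable def condProbGiven {n L : ℕ} (P : Fin n → Fin L → ℝ)
    (i k : Fin n) (ℓ : Fin L) : ℝ :=
  ∑ lam : Fin n → Fin L,
    if lam i = ℓ then (∏ j ∈ Finset.univ.erase i, P j (lam j)) * condRank lam i k
    else 0


lemma condRank_succ {n m : ℕ} (lam : Fin n → Fin m) (i k : Fin n) :
    condRank (fun j => (lam j).succ) i k = condRank lam i k := by
  have h1 : nGT (fun j => (lam j).succ) (lam i).succ = nGT lam (lam i) := by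
    simp [nGT]
  have h2 : nEQ (fun j => (lam j).succ) (lam i).succ = nEQ lam (lam i) := by
    simp [nEQ]
  unfold condRank
  rw [h1, h2]

lemma rUA_cons {n m : ℕ} (P : Fin n → Fin m → ℝ) :
    rUA (fun j => (Fin.cons 0 (P j) : Fin (m + 1) → ℝ)) = rUA P := by
  funext i k
  unfold rUA
  symm
  apply Finset.sum_of_injOn (fun (lam : Fin n → Fin m) j => (lam j).succ)
  · intro a _ b _ h
    funext j
    exact Fin.succ_injective _ (congrFun h j)
  · intro a _
    simp
  · intro lam _ hlam
    have : ∃ j, lam j = 0 := by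
      by_contra! h
      apply hlam
      refine ⟨fun j => (lam j).pred (h j), by simp, ?_⟩
      funext j
      simp
    obtain ⟨j, hj⟩ := this
    rw [Finset.prod_eq_zero (Finset.mem_univ j), zero_mul]
    rw [hj]
    rfl
  · intro lam _
    rw [condRank_succ]
    simp

lemma rUA_det {n L : ℕ} (lam : Fin n → Fin L) :
    rUA (fun j l => if l = lam j then (1 : ℝ) else 0) = condRank lam := by
  funext i k
  unfold rUA
  rw [Finset.sum_eq_single lam]
  · simp
  · intro b _ hb
    obtain ⟨j, hj⟩ := Function.ne_iff.mp hb
    rw [Finset.prod_eq_zero (Finset.mem_univ j), zero_mul]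
    simp [hj]
  · simp

lemma condRank_nonneg {n L : ℕ} (lam : Fin n → Fin L) (i k : Fin n) :
    0 ≤ condRank lam i k := by
  unfold condRank
  split_ifs <;> positivity

lemma nGT_add_nEQ_le {n L : ℕ} (lam : Fin n → Fin L) (l : Fin L) :
    nGT lam l + nEQ lam l ≤ n := by
  unfold nGT nEQ
  rw [← Finset.card_union_of_disjoint]
  · exact (Finset.card_le_univ _).trans (by simp)
  · rw [Finset.disjoint_filter]
    intro j _ h1 h2
    exact absurd h2 h1.ne'

lemma nEQ_pos {n L : ℕ} (lam : Fin n → Fin L) (i : Fin n) : 0 < nEQ lam (lam i) :=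
  Finset.card_pos.mpr ⟨i, by simp⟩

lemma condRank_ne_zero {n L : ℕ} (lam : Fin n → Fin L) (i k : Fin n) :
    condRank lam i k ≠ 0 ↔
      nGT lam (lam i) ≤ k.val ∧ k.val < nGT lam (lam i) + nEQ lam (lam i) := by
  have := nEQ_pos lam i
  unfold condRank
  split_ifs with h
  · simp only [h, and_self, iff_true]
    positivity
  · simp [h]

/-- If the support of the conditional ranks refines that of a strict one, it is strict. -/
lemma nEQ_eq_one_of {n L L' : ℕ} (lam : Fin n → Fin L) (mu : Fin n → Fin L') (i : Fin n)
    (hmu : nEQ mu (mu i) = 1)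
    (h : ∀ k, condRank lam i k ≠ 0 → condRank mu i k ≠ 0) : nEQ lam (lam i) = 1 := by
  have h0 := nEQ_pos lam i
  have hle := nGT_add_nEQ_le lam (lam i)
  by_contra hne
  have h1 := h ⟨nGT lam (lam i), by omega⟩ (by rw [condRank_ne_zero]; simp; omega)
  have h2 := h ⟨nGT lam (lam i) + 1, by omega⟩ (by rw [condRank_ne_zero]; simp; omega)
  rw [condRank_ne_zero] at h1 h2
  simp only at h1 h2
  omega

/-- The expressivity of UA ranking functions strictly
increases in the number of labels: for `n ≥ L ≥ 2`, the image of the UA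
ranking function on `n × (L−1)` prediction matrices is strictly contained in
the image of the UA ranking function on `n × L` prediction matrices. -/
theorem rUA_image_strict_mono
    (n L : ℕ) (hL : 2 ≤ L) (hn : L ≤ n) :
    {M : Fin n → Fin n → ℝ |
        ∃ P : Fin n → Fin (L - 1) → ℝ, rowStochastic P ∧ rUA P = M} ⊂
      {M : Fin n → Fin n → ℝ |
        ∃ P : Fin n → Fin L → ℝ, rowStochastic P ∧ rUA P = M} := by
  obtain ⟨m, rfl⟩ : ∃ m, L = m + 1 := ⟨L - 1, by omega⟩
  change {M : Fin n → Fin n → ℝ | ∃ P : Fin n → Fin m → ℝ, rowStochastic P ∧ rUA P = M} ⊂ _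
  rw [Set.ssubset_iff_of_subset]
  · let mu : Fin n → Fin (m + 1) := fun i => ⟨min i.val m, by omega⟩
    refine ⟨condRank mu, ⟨_, ⟨?_, ?_⟩, rUA_det mu⟩, ?_⟩
    · intro i l
      split_ifs <;> norm_num
    · intro i
      simp
    · rintro ⟨P, ⟨hP0, hP1⟩, hP⟩
      have hex : ∀ j, ∃ l, P j l ≠ 0 := by
        intro j
        by_contra! h
        have := hP1 j
        simp [h] at this
      choose lam hlam using hex
      have hprod : 0 < ∏ j, P j (lam j) :=
        Finset.prod_pos fun j _ => lt_of_le_of_ne (hP0 j _) (hlam j).symm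
      have hsupp : ∀ i k, condRank lam i k ≠ 0 → condRank mu i k ≠ 0 := by
        intro i k h
        rw [← hP]
        apply ne_of_gt
        apply Finset.sum_pos'
        · intro nu _
          exact mul_nonneg (Finset.prod_nonneg fun j _ => hP0 j _) (condRank_nonneg _ _ _)
        · exact ⟨lam, Finset.mem_univ _,
            mul_pos hprod (lt_of_le_of_ne (condRank_nonneg _ _ _) h.symm)⟩
      have hone : ∀ i : Fin n, i.val < m → nEQ lam (lam i) = 1 := by
        intro i hi
        apply nEQ_eq_one_of lam mu i _ (hsupp i)
        unfold nEQ
        rw [Finset.card_eq_one]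
        refine ⟨i, ?_⟩
        ext j
        simp only [mu, Finset.mem_filter, Finset.mem_univ, true_and, Finset.mem_singleton,
          Fin.ext_iff]
        omega
      have huniq : ∀ i j : Fin n, i.val < m → lam j = lam i → j = i := by
        intro i j hi hij
        have h1 := (hone i hi).le
        unfold nEQ at h1
        rw [Finset.card_le_one] at h1
        exact h1 j (by simp [hij]) i (by simp)
      have hinj : Function.Injective (fun a : Fin (m + 1) => lam (Fin.castLE hn a)) := by
        intro a b hab
        dsimp only at hab
        by_cases ha : a.val < m
        · exact (Fin.castLE_injective hn (huniq (Fin.castLE hn a) _ ha hab.symm)).symm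
        · by_cases hb : b.val < m
          · exact Fin.castLE_injective hn (huniq (Fin.castLE hn b) _ hb hab)
          · ext
            omega
      have := Fintype.card_le_of_injective _ hinj
      simp at this
  · rintro M ⟨P, ⟨hP0, hP1⟩, rfl⟩
    refine ⟨_, ⟨?_, ?_⟩, rUA_cons P⟩
    · intro i l
      refine Fin.cases ?_ (fun l => ?_) l
      · simp
      · simpa using hP0 i l
    · intro i
      simpa [Fin.sum_univ_succ] using hP1 i
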